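/- Let t ∈ ℕ and j ∈ {1,…,n}. (i) Let p ∈ {1,…,j−1} and assume H_{p−1}^l(j) = 0 for all l with 0 ≤ l ≤ t−1. Let z ∈ C_p^t(j) be such that ∂_j(z) = d(y) for some y ∈ C_p^{t−1}(j). Then there exists r ∈ C_{p+1}^{t−1}(j) such that z̃ := z + d(r) satisfies ∂_j(z̃) = 0, i.e., z̃_J = 0 for every p-subset J containing j; in particular, if z ∈ Z_p^t(j), then z̃ ∈ Z_p^t(j), z̃ is supported on subsets of {1,…,j−1}, and z̃ and z have the same class in H_p^t(j). (ii) Assume H_{j−1}^l(j) = 0 for all l with 0 ≤ l ≤ t−1. If z ∈ C_j^t(j) satisfies ∂_j(z) = d(y) for some y ∈ C_j^{t−1}(j), then z = 0; in particular, for every nonzero z ∈ Z_j^t(j), the element ∂_j(z) lies in Z_{j−1}^t(j) and its class in H_{j−1}^t(j) is nonzero. -/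

import Mathlib

open MvPolynomial

noncomputable section

/-- The Koszul differential on families of module elements indexed by finite subsets
of `Fin n`. -/
def koszulD (n : ℕ) {K : Type*} [Field K] {M : Type*} [AddCommGroup M] [Module K M]
    [Module (MvPolynomial (Fin n) K) M] [IsScalarTower K (MvPolynomial (Fin n) K) M] :
    (Finset (Fin n) → M) →ₗ[K] (Finset (Fin n) → M) where
  toFun m L := ∑ k ∈ Lᶜ, ((-1 : ℤ) ^ (L.filter (fun l => l < k)).card) •
      ((X k : MvPolynomial (Fin n) K) • m (insert k L))
  map_add' a b := by
    funext L
    simp [smul_add, Finset.sum_add_distrib]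
  map_smul' c a := by
    funext L
    simp only [Pi.smul_apply, RingHom.id_apply, Finset.smul_sum]
    refine Finset.sum_congr rfl fun k _ => ?_
    rw [smul_comm (X k : MvPolynomial (Fin n) K) c, smul_comm ((-1 : ℤ) ^ (L.filter (fun l => l < k)).card) c]

/-- The degree-`(i, i+t)` piece of the Koszul complex of `x_1, …, x_j` with values in the
graded module with graded pieces `gr`: families `(m_J)` with `m_J ∈ gr t`, supported on
`i`-element subsets of `{1, …, j}` (i.e. of `{0, …, j-1}` in `Fin n`). -/
def koszulC (n : ℕ) {K : Type*} [Field K] {M : Type*} [AddCommGroup M] [Module K M]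
    (gr : ℤ → Submodule K M) (i : ℕ) (t : ℤ) (j : ℕ) :
    Submodule K (Finset (Fin n) → M) where
  carrier := {m | ∀ J : Finset (Fin n),
    m J ∈ gr t ∧ (¬(J.card = i ∧ ∀ k ∈ J, (k : ℕ) < j) → m J = 0)}
  zero_mem' := fun J => ⟨(gr t).zero_mem, fun _ => rfl⟩
  add_mem' := by
    intro a b ha hb J
    refine ⟨(gr t).add_mem (ha J).1 (hb J).1, fun h => ?_⟩
    simp [Pi.add_apply, (ha J).2 h, (hb J).2 h]
  smul_mem' := by
    intro c a ha J
    exact ⟨(gr t).smul_mem c (ha J).1, fun h => by simp [Pi.smul_apply, (ha J).2 h]⟩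

/-- Cycles: `Z_i^t(j)`. -/
def koszulZ (n : ℕ) {K : Type*} [Field K] {M : Type*} [AddCommGroup M] [Module K M]
    [Module (MvPolynomial (Fin n) K) M] [IsScalarTower K (MvPolynomial (Fin n) K) M]
    (gr : ℤ → Submodule K M) (i : ℕ) (t : ℤ) (j : ℕ) :
    Submodule K (Finset (Fin n) → M) :=
  koszulC n gr i t j ⊓ LinearMap.ker (koszulD n)

/-- Boundaries: `B_i^t(j)`, the image of `C_{i+1}^{t-1}(j)` under the differential. -/
def koszulB (n : ℕ) {K : Type*} [Field K] {M : Type*} [AddCommGroup M] [Module K M]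
    [Module (MvPolynomial (Fin n) K) M] [IsScalarTower K (MvPolynomial (Fin n) K) M]
    (gr : ℤ → Submodule K M) (i : ℕ) (t : ℤ) (j : ℕ) :
    Submodule K (Finset (Fin n) → M) :=
  (koszulC n gr (i + 1) (t - 1) j).map (koszulD n)

/-- The contraction `∂_k`. -/
def koszulContr (n : ℕ) {M : Type*} [AddCommGroup M] (k : Fin n)
    (m : Finset (Fin n) → M) : Finset (Fin n) → M :=
  fun L => if k ∈ L then 0
    else ((-1 : ℤ) ^ (L.filter (fun l => l < k)).card) • m (insert k L)

end

section

variable {n : ℕ} {M : Type*} [AddCommGroup M]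

theorem koszulContr_apply_of_mem {k : Fin n} {L : Finset (Fin n)} (h : k ∈ L)
    (m : Finset (Fin n) → M) : koszulContr n k m L = 0 :=
  if_pos h

theorem koszulContr_apply_of_notMem {k : Fin n} {L : Finset (Fin n)} (h : k ∉ L)
    (m : Finset (Fin n) → M) :
    koszulContr n k m L =
      ((-1 : ℤ) ^ (L.filter (fun l => l < k)).card) • m (insert k L) :=
  if_neg h

theorem koszulContr_add (k : Fin n) (a b : Finset (Fin n) → M) :
    koszulContr n k (a + b) = koszulContr n k a + koszulContr n k b := by
  funext L
  by_cases h : k ∈ L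
  · simp [koszulContr_apply_of_mem h]
  · simp [koszulContr_apply_of_notMem h]

/-- The vanishing of a contraction detects the vanishing of all components indexed by sets
containing the contracted index. -/
theorem koszulContr_eq_zero_iff (k : Fin n) (m : Finset (Fin n) → M) :
    koszulContr n k m = 0 ↔ ∀ J : Finset (Fin n), k ∈ J → m J = 0 := by
  constructor
  · intro h J hJ
    have h1 := congrFun h (J.erase k)
    rw [koszulContr_apply_of_notMem (Finset.notMem_erase k J), Finset.insert_erase hJ] at h1
    rcases neg_one_pow_eq_or ℤ ((J.erase k).filter (fun l => l < k)).card with h2 | h2 <;>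
      simpa [h2] using h1
  · intro h
    funext L
    by_cases hL : k ∈ L
    · exact koszulContr_apply_of_mem hL m
    · rw [koszulContr_apply_of_notMem hL, h _ (Finset.mem_insert_self k L), smul_zero,
        Pi.zero_apply]

theorem koszulContr_self (k : Fin n) (m : Finset (Fin n) → M) :
    koszulContr n k (koszulContr n k m) = 0 :=
  (koszulContr_eq_zero_iff k _).2 fun _ hJ => koszulContr_apply_of_mem hJ m

theorem koszulContr_anticomm_of_lt {a b : Fin n} (hab : a < b) (m : Finset (Fin n) → M) :
    koszulContr n a (koszulContr n b m) = -koszulContr n b (koszulContr n a m) := by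
  funext L
  rw [Pi.neg_apply]
  by_cases ha : a ∈ L
  · rw [koszulContr_apply_of_mem ha]
    by_cases hb : b ∈ L
    · rw [koszulContr_apply_of_mem hb, neg_zero]
    · rw [koszulContr_apply_of_notMem hb,
        koszulContr_apply_of_mem (Finset.mem_insert_of_mem ha), smul_zero, neg_zero]
  by_cases hb : b ∈ L
  · rw [koszulContr_apply_of_mem hb, koszulContr_apply_of_notMem ha,
      koszulContr_apply_of_mem (Finset.mem_insert_of_mem hb), smul_zero, neg_zero]
  have hb' : b ∉ insert a L := by simp [hb, hab.ne']
  have ha' : a ∉ insert b L := by simp [ha, hab.ne]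
  rw [koszulContr_apply_of_notMem ha, koszulContr_apply_of_notMem hb,
    koszulContr_apply_of_notMem hb', koszulContr_apply_of_notMem ha',
    Finset.filter_insert, if_pos hab, Finset.filter_insert, if_neg hab.not_gt,
    Finset.card_insert_of_notMem (by simp [ha]), Finset.insert_comm b a L, pow_succ,
    smul_smul, smul_smul, ← neg_smul]
  congr 1
  ring

theorem koszulContr_anticomm (a b : Fin n) (m : Finset (Fin n) → M) :
    koszulContr n a (koszulContr n b m) = -koszulContr n b (koszulContr n a m) := by
  rcases lt_trichotomy a b with h | rfl | h
  · exact koszulContr_anticomm_of_lt h m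
  · rw [koszulContr_self, neg_zero]
  · rw [koszulContr_anticomm_of_lt h m, neg_neg]

/-- Exterior multiplication by the `k`-th basis vector, a one-sided inverse of `koszulContr n k`
on families whose components at sets containing `k` vanish. -/
def koszulExt (n : ℕ) {M : Type*} [AddCommGroup M] (k : Fin n)
    (m : Finset (Fin n) → M) : Finset (Fin n) → M :=
  fun J => if k ∈ J then
    ((-1 : ℤ) ^ ((J.erase k).filter (fun l => l < k)).card) • m (J.erase k) else 0

theorem koszulContr_koszulExt {k : Fin n} {m : Finset (Fin n) → M}
    (h : koszulContr n k m = 0) : koszulContr n k (koszulExt n k m) = m := by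
  funext L
  by_cases hL : k ∈ L
  · rw [koszulContr_apply_of_mem hL, (koszulContr_eq_zero_iff k m).1 h L hL]
  · rw [koszulContr_apply_of_notMem hL, koszulExt, if_pos (Finset.mem_insert_self k L),
      Finset.erase_insert hL, smul_smul, ← mul_pow, neg_one_mul, neg_neg, one_pow, one_smul]

section

variable {K : Type*} [Field K] [Module K M] {gr : ℤ → Submodule K M}

theorem koszulContr_mem_koszulC {i : ℕ} {t : ℤ} {j : ℕ} (k : Fin n)
    {m : Finset (Fin n) → M} (hm : m ∈ koszulC n gr (i + 1) t j) :
    koszulContr n k m ∈ koszulC n gr i t j := by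
  intro L
  by_cases hL : k ∈ L
  · rw [koszulContr_apply_of_mem hL]
    exact ⟨(gr t).zero_mem, fun _ => rfl⟩
  · rw [koszulContr_apply_of_notMem hL]
    refine ⟨zsmul_mem (hm _).1 _, fun h => ?_⟩
    rw [(hm _).2, smul_zero]
    rintro ⟨h1, h2⟩
    rw [Finset.card_insert_of_notMem hL] at h1
    exact h ⟨by omega, fun l hl => h2 l (Finset.mem_insert_of_mem hl)⟩

theorem koszulExt_mem_koszulC {i : ℕ} {t : ℤ} {j : ℕ} {k : Fin n} (hk : (k : ℕ) < j)
    {m : Finset (Fin n) → M} (hm : m ∈ koszulC n gr i t j) :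
    koszulExt n k m ∈ koszulC n gr (i + 1) t j := by
  intro J
  unfold koszulExt
  split_ifs with hJ
  · refine ⟨zsmul_mem (hm _).1 _, fun h => ?_⟩
    rw [(hm _).2, smul_zero]
    rintro ⟨h1, h2⟩
    refine h ⟨by rw [← Finset.card_erase_add_one hJ, h1], fun l hl => ?_⟩
    by_cases hlk : l = k
    · rwa [hlk]
    · exact h2 l (Finset.mem_erase.2 ⟨hlk, hl⟩)
  · exact ⟨(gr t).zero_mem, fun _ => rfl⟩

theorem eq_zero_of_mem_koszulC_of_eq_bot {i : ℕ} {t : ℤ} {j : ℕ} (ht : gr t = ⊥)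
    {m : Finset (Fin n) → M} (hm : m ∈ koszulC n gr i t j) : m = 0 := by
  funext J
  simpa [ht] using (hm J).1

theorem eq_zero_of_mem_koszulC_of_lt {i : ℕ} {t : ℤ} {j : ℕ} (hij : j < i)
    {m : Finset (Fin n) → M} (hm : m ∈ koszulC n gr i t j) : m = 0 := by
  funext J
  refine (hm J).2 fun ⟨h1, h2⟩ => ?_
  have h3 : (J.map Fin.valEmbedding).card ≤ (Finset.range j).card :=
    Finset.card_le_card fun x hx => by
      obtain ⟨k, hk, rfl⟩ := Finset.mem_map.1 hx
      exact Finset.mem_range.2 (h2 k hk)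
  rw [Finset.card_map, Finset.card_range] at h3
  omega

/-- A family in `C_i^t(j)` without components at sets containing the last index lies
in `C_i^t(j - 1)`. -/
theorem mem_koszulC_of_koszulContr_eq_zero {i : ℕ} {t : ℤ} {j : ℕ} {k : Fin n}
    (hk : (k : ℕ) = j - 1) {m : Finset (Fin n) → M} (hm : m ∈ koszulC n gr i t j)
    (h : koszulContr n k m = 0) : m ∈ koszulC n gr i t (j - 1) := by
  refine fun J => ⟨(hm J).1, fun hJ => ?_⟩
  by_cases hkJ : k ∈ J
  · exact (koszulContr_eq_zero_iff k m).1 h J hkJ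
  · refine (hm J).2 fun ⟨h1, h2⟩ => hJ ⟨h1, fun l hl => ?_⟩
    have h3 := h2 l hl
    have h4 : (l : ℕ) ≠ k := fun e => hkJ (Fin.ext e ▸ hl)
    omega

end

section

variable {K : Type*} [Field K] [Module (MvPolynomial (Fin n) K) M]

theorem koszulContr_sum_X_smul (k : Fin n) (f : Fin n → Finset (Fin n) → M) :
    koszulContr n k (fun L => ∑ i, (X i : MvPolynomial (Fin n) K) • f i L) =
      fun L => ∑ i, (X i : MvPolynomial (Fin n) K) • koszulContr n k (f i) L := by
  funext L
  by_cases h : k ∈ L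
  · simp [koszulContr_apply_of_mem h]
  · simp only [koszulContr_apply_of_notMem h, Finset.smul_sum]
    exact Finset.sum_congr rfl fun i _ => smul_comm _ _ _

variable [Module K M] [IsScalarTower K (MvPolynomial (Fin n) K) M]

/-- The Koszul differential is `∑ k, x_k ∂_k`. -/
theorem koszulD_eq_sum (m : Finset (Fin n) → M) :
    koszulD n (K := K) m =
      fun L => ∑ k, (X k : MvPolynomial (Fin n) K) • koszulContr n k m L := by
  funext L
  change ∑ k ∈ Lᶜ, _ = _
  rw [← Finset.sum_subset (Finset.subset_univ Lᶜ) fun k _ hk => by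
    rw [koszulContr_apply_of_mem (by simpa using hk), smul_zero]]
  refine Finset.sum_congr rfl fun k hk => ?_
  rw [koszulContr_apply_of_notMem (by simpa using hk), smul_comm]

theorem koszulContr_koszulD (k : Fin n) (m : Finset (Fin n) → M) :
    koszulContr n k (koszulD n (K := K) m) = -koszulD n (K := K) (koszulContr n k m) := by
  rw [koszulD_eq_sum, koszulD_eq_sum, koszulContr_sum_X_smul]
  funext L
  simp only [koszulContr_anticomm k _ m, Pi.neg_apply, smul_neg, Finset.sum_neg_distrib]

theorem koszulD_koszulD (m : Finset (Fin n) → M) :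
    koszulD n (K := K) (koszulD n (K := K) m) = 0 := by
  rw [koszulD_eq_sum]
  funext L
  simp only [koszulD_eq_sum m, koszulContr_sum_X_smul, Finset.smul_sum, smul_smul]
  rw [← Finset.sum_product', Pi.zero_apply]
  refine Finset.sum_involution (fun q _ => q.swap) ?_ ?_ (by simp) (by simp)
  · rintro ⟨a, b⟩ -
    simp only [Prod.fst_swap, Prod.snd_swap]
    rw [koszulContr_anticomm a b, mul_comm (X b), Pi.neg_apply, smul_neg, neg_add_cancel]
  · rintro ⟨a, b⟩ - h e
    obtain rfl : b = a := congrArg Prod.fst e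
    simp [koszulContr_self] at h

variable {gr : ℤ → Submodule K M}

theorem koszulD_mem_koszulC
    (hcompat : ∀ (i : Fin n) (l : ℤ), ∀ m ∈ gr l,
      (X i : MvPolynomial (Fin n) K) • m ∈ gr (l + 1))
    {i : ℕ} {t : ℤ} {j : ℕ} {m : Finset (Fin n) → M}
    (hm : m ∈ koszulC n gr (i + 1) (t - 1) j) :
    koszulD n (K := K) m ∈ koszulC n gr i t j := by
  rw [koszulD_eq_sum]
  refine fun L => ⟨sum_mem fun k _ => ?_, fun hL => Finset.sum_eq_zero fun k _ => ?_⟩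
  · simpa using hcompat k _ _ (koszulContr_mem_koszulC k hm L).1
  · rw [(koszulContr_mem_koszulC k hm L).2 hL, smul_zero]

theorem koszulContr_mem_koszulZ {i : ℕ} {t : ℤ} {j : ℕ} (k : Fin n)
    {m : Finset (Fin n) → M} (hm : m ∈ koszulC n gr (i + 1) t j)
    (h : koszulContr n k (koszulD n (K := K) m) = 0) :
    koszulContr n k m ∈ koszulZ n gr i t j :=
  ⟨koszulContr_mem_koszulC k hm, by
    rwa [koszulContr_koszulD, neg_eq_zero] at h⟩

/-- If the Koszul homology in homological degree `p` vanishes in all degrees below `t` and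
`∂_k z` is a boundary, then `z` can be corrected by a boundary so that `∂_k` kills it. -/
theorem exists_koszulContr_add_koszulD_eq_zero
    (hcompat : ∀ (i : Fin n) (l : ℤ), ∀ m ∈ gr l,
      (X i : MvPolynomial (Fin n) K) • m ∈ gr (l + 1))
    (hneg : ∀ l : ℤ, l < 0 → gr l = ⊥) {j : ℕ} {k : Fin n} (hk : (k : ℕ) < j)
    (p t : ℕ)
    (hH : ∀ l : ℕ, l < t → koszulZ n gr p (l : ℤ) j ≤ koszulB n gr p (l : ℤ) j)
    (z : Finset (Fin n) → M) {y : Finset (Fin n) → M}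
    (hy : y ∈ koszulC n gr (p + 1) ((t : ℤ) - 1) j)
    (hzy : koszulContr n k z = koszulD n (K := K) y) :
    ∃ r ∈ koszulC n gr (p + 2) ((t : ℤ) - 1) j,
      koszulContr n k (z + koszulD n (K := K) r) = 0 := by
  induction t generalizing z y with
  | zero =>
    refine ⟨0, zero_mem _, ?_⟩
    rw [eq_zero_of_mem_koszulC_of_eq_bot (hneg _ (by simp)) hy, map_zero] at hzy
    rwa [map_zero, add_zero]
  | succ t ih =>
    rw [Nat.cast_succ, add_sub_cancel_right] at hy ⊢
    obtain ⟨y', hy', hyy'⟩ := hH t t.lt_succ_self <| koszulContr_mem_koszulZ k hy <| by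
      rw [← hzy, koszulContr_self]
    obtain ⟨r', hr', hr0⟩ := ih (fun l hl => hH l (hl.trans t.lt_succ_self)) y hy' hyy'.symm
    refine ⟨koszulExt n k (y + koszulD n (K := K) r'),
      koszulExt_mem_koszulC hk (add_mem hy (koszulD_mem_koszulC hcompat hr')), ?_⟩
    rw [koszulContr_add, koszulContr_koszulD, koszulContr_koszulExt hr0, map_add,
      koszulD_koszulD, add_zero, hzy, add_neg_cancel]

end

end

open MvPolynomial in
/-- Lemma 2.2: (i) if `p < j`, `H_{p-1}^l(j) = 0` for `l < t` and
`∂_j(z)` is a boundary, then `z` can be corrected by a boundary to a `z̃` with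
`∂_j(z̃) = 0`; in particular a cycle `z` is homologous to a cycle supported on
subsets of `{1, …, j-1}`.  (ii) if `p = j` and `∂_j(z)` is a boundary then `z = 0`;
in particular for a nonzero cycle `z ∈ Z_j^t(j)` the contraction `∂_j(z)` is a
cycle whose class in `H_{j-1}^t(j)` is nonzero. -/
theorem koszul_contraction_correction {K : Type*} [Field K] {n : ℕ}
    {M : Type*} [AddCommGroup M] [Module K M]
    [Module (MvPolynomial (Fin n) K) M] [IsScalarTower K (MvPolynomial (Fin n) K) M]
    (gr : ℤ → Submodule K M)
    (hdecomp : DirectSum.IsInternal gr)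
    (hcompat : ∀ (i : Fin n) (l : ℤ), ∀ m ∈ gr l,
      (X i : MvPolynomial (Fin n) K) • m ∈ gr (l + 1))
    (hneg : ∀ l : ℤ, l < 0 → gr l = ⊥)
    (t : ℕ) (j : ℕ) (hj1 : 1 ≤ j) (hjn : j ≤ n) :
    (∀ p : ℕ, 1 ≤ p → p < j →
      (∀ l : ℕ, l < t → koszulZ n gr (p - 1) (l : ℤ) j ≤ koszulB n gr (p - 1) (l : ℤ) j) →
      ∀ z ∈ koszulC n gr p (t : ℤ) j, ∀ y ∈ koszulC n gr p ((t : ℤ) - 1) j,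
        koszulContr n ⟨j - 1, lt_of_lt_of_le (Nat.sub_lt hj1 one_pos) hjn⟩ z = koszulD n (K := K) y →
        ∃ r ∈ koszulC n gr (p + 1) ((t : ℤ) - 1) j,
          (∀ J : Finset (Fin n), (⟨j - 1, lt_of_lt_of_le (Nat.sub_lt hj1 one_pos) hjn⟩ : Fin n) ∈ J →
            (z + koszulD n (K := K) r) J = 0) ∧
          (z ∈ koszulZ n gr p (t : ℤ) j →
            (z + koszulD n (K := K) r) ∈ koszulZ n gr p (t : ℤ) j ∧
            (z + koszulD n (K := K) r) ∈ koszulC n gr p (t : ℤ) (j - 1) ∧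
            (z + koszulD n (K := K) r) - z ∈ koszulB n gr p (t : ℤ) j)) ∧
    ((∀ l : ℕ, l < t → koszulZ n gr (j - 1) (l : ℤ) j ≤ koszulB n gr (j - 1) (l : ℤ) j) →
      (∀ z ∈ koszulC n gr j (t : ℤ) j, ∀ y ∈ koszulC n gr j ((t : ℤ) - 1) j,
        koszulContr n ⟨j - 1, lt_of_lt_of_le (Nat.sub_lt hj1 one_pos) hjn⟩ z = koszulD n (K := K) y →
        z = 0) ∧
      (∀ z ∈ koszulZ n gr j (t : ℤ) j, z ≠ 0 →
        koszulContr n ⟨j - 1, lt_of_lt_of_le (Nat.sub_lt hj1 one_pos) hjn⟩ z ∈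
          koszulZ n gr (j - 1) (t : ℤ) j ∧
        koszulContr n ⟨j - 1, lt_of_lt_of_le (Nat.sub_lt hj1 one_pos) hjn⟩ z ∉
          koszulB n gr (j - 1) (t : ℤ) j)) := by
  set k : Fin n := ⟨j - 1, lt_of_lt_of_le (Nat.sub_lt hj1 one_pos) hjn⟩
  have hk : (k : ℕ) < j := Nat.sub_lt hj1 one_pos
  refine ⟨?_, fun hH => ?_⟩
  · rintro p hp - hH z hz y hy hzy
    obtain ⟨p, rfl⟩ := Nat.exists_eq_add_of_le' hp
    obtain ⟨r, hr, hr0⟩ :=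
      exists_koszulContr_add_koszulD_eq_zero hcompat hneg hk p t hH z hy hzy
    have hC := add_mem hz (koszulD_mem_koszulC hcompat hr)
    refine ⟨r, hr, (koszulContr_eq_zero_iff k _).1 hr0, fun hzZ => ⟨⟨hC, ?_⟩, ?_, ?_⟩⟩
    · exact add_mem hzZ.2 (LinearMap.mem_ker.2 (koszulD_koszulD r))
    · exact mem_koszulC_of_koszulContr_eq_zero rfl hC hr0
    · rw [add_sub_cancel_left]
      exact Submodule.mem_map_of_mem hr
  · obtain ⟨q, rfl⟩ := Nat.exists_eq_add_of_le' hj1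
    have hinj : ∀ z ∈ koszulC n gr (q + 1) (t : ℤ) (q + 1),
        ∀ y ∈ koszulC n gr (q + 1) ((t : ℤ) - 1) (q + 1),
        koszulContr n k z = koszulD n (K := K) y → z = 0 := by
      intro z hz y hy hzy
      obtain ⟨r, hr, hr0⟩ :=
        exists_koszulContr_add_koszulD_eq_zero hcompat hneg hk q t hH z hy hzy
      rw [eq_zero_of_mem_koszulC_of_lt (by omega) hr, map_zero, add_zero] at hr0
      exact eq_zero_of_mem_koszulC_of_lt (by omega)
        (mem_koszulC_of_koszulContr_eq_zero rfl hz hr0)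
    refine ⟨hinj, fun z hz hz0 => ⟨koszulContr_mem_koszulZ k hz.1 ?_, ?_⟩⟩
    · rw [LinearMap.mem_ker.1 hz.2, koszulContr_eq_zero_iff]
      exact fun _ _ => rfl
    · rintro ⟨y, hy, hyz⟩
      exact hz0 (hinj z hz.1 y hy hyz.symm)
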